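/- Let α, β > −1, N ≥ 2, let −1 < z_{1,N} < ... < z_{N,N} < 1 be the ordered roots of the Jacobi polynomial P_N^{(α,β)}, and let M = max_{j=1,...,N} 2j(2N + α + β + 1 − j). Then for every i ∈ {1,...,N−1}, z_{i+1,N} − z_{i,N} ≥ (2^{7/4}/M)·(min(α+1, β+1))^{1/2}. Moreover, if α = β, then for every i ∈ {1,...,N−1}, z_{i+1,N} − z_{i,N} ≥ 2^{11/4}·(α+1)^{1/2}/sqrt(M(M + 4(α+1))). -/

import Mathlib

/-- The Jacobi polynomials `P_n^{(a,b)}`, orthogonal w.r.t. the weight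
`(1-x)^a·(1+x)^b` on `(-1,1)` (for `a, b > -1`), defined via the standard
three-term recurrence
`P_0 = 1`, `P_1 = (a-b)/2 + ((a+b+2)/2)·X`, and for `n ≥ 2`:
`2n(n+a+b)(2n+a+b-2)·P_n
  = (2n+a+b-1)·[(2n+a+b)(2n+a+b-2)·X + a²-b²]·P_{n-1}
    - 2(n+a-1)(n+b-1)(2n+a+b)·P_{n-2}`. -/
noncomputable def jacobiP (a b : ℝ) : ℕ → Polynomial ℝ
  | 0 => 1
  | 1 => Polynomial.C ((a - b) / 2) + Polynomial.C ((a + b + 2) / 2) * Polynomial.X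
  | n + 2 =>
      Polynomial.C
          (1 / (2 * ((n : ℝ) + 2) * (((n : ℝ) + 2) + a + b)
            * (2 * ((n : ℝ) + 2) + a + b - 2))) *
        (Polynomial.C (2 * ((n : ℝ) + 2) + a + b - 1) *
            ((Polynomial.C ((2 * ((n : ℝ) + 2) + a + b)
                * (2 * ((n : ℝ) + 2) + a + b - 2)) * Polynomial.X
              + Polynomial.C (a ^ 2 - b ^ 2)) * jacobiP a b (n + 1))
          - Polynomial.C (2 * (((n : ℝ) + 2) + a - 1) * (((n : ℝ) + 2) + b - 1)
              * (2 * ((n : ℝ) + 2) + a + b)) * jacobiP a b n)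

open Polynomial in
theorem jacobiP_recurrence {a b : ℝ} (ha : -1 < a) (hb : -1 < b) (n : ℕ) :
    C (2 * ((n : ℝ) + 2) * (((n : ℝ) + 2) + a + b) * (2 * ((n : ℝ) + 2) + a + b - 2)) *
        jacobiP a b (n + 2) =
      C (2 * ((n : ℝ) + 2) + a + b - 1) *
            ((C ((2 * ((n : ℝ) + 2) + a + b) * (2 * ((n : ℝ) + 2) + a + b - 2)) * X
              + C (a ^ 2 - b ^ 2)) * jacobiP a b (n + 1))
          - C (2 * (((n : ℝ) + 2) + a - 1) * (((n : ℝ) + 2) + b - 1)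
              * (2 * ((n : ℝ) + 2) + a + b)) * jacobiP a b n := by
  have hn : (0 : ℝ) ≤ n := n.cast_nonneg
  have hD : 2 * ((n : ℝ) + 2) * (((n : ℝ) + 2) + a + b) * (2 * ((n : ℝ) + 2) + a + b - 2) ≠ 0 := by
    have h1 : 0 < ((n : ℝ) + 2) + a + b := by linarith
    have h2 : 0 < 2 * ((n : ℝ) + 2) + a + b - 2 := by linarith
    positivity
  rw [jacobiP, ← mul_assoc, ← C_mul, mul_one_div_cancel hD, C_1, one_mul]

open Polynomial in
theorem natDegree_jacobiP_le (a b : ℝ) (n : ℕ) : (jacobiP a b n).natDegree ≤ n := by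
  induction n using Nat.twoStepInduction with
  | zero => simp [jacobiP]
  | one => rw [jacobiP]; compute_degree
  | more n h0 h1 =>
    rw [jacobiP]
    refine (natDegree_C_mul_le _ _).trans ((natDegree_sub_le _ _).trans (max_le ?_ ?_))
    · refine (natDegree_C_mul_le _ _).trans (natDegree_mul_le.trans ?_)
      have : (C ((2 * ((n : ℝ) + 2) + a + b) * (2 * ((n : ℝ) + 2) + a + b - 2)) * X
              + C (a ^ 2 - b ^ 2)).natDegree ≤ 1 := by compute_degree
      omega
    · exact (natDegree_C_mul_le _ _).trans (by omega)

open Polynomial in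
/-- The two first-order structure relations between consecutive Jacobi polynomials. -/
theorem jacobiP_structure {a b : ℝ} (ha : -1 < a) (hb : -1 < b) (n : ℕ) (x : ℝ) :
    (2 * n + 2 + a + b) * (1 - x ^ 2) * (derivative (jacobiP a b (n + 1))).eval x =
        (n + 1) * (a - b - (2 * n + 2 + a + b) * x) * (jacobiP a b (n + 1)).eval x
          + 2 * (n + 1 + a) * (n + 1 + b) * (jacobiP a b n).eval x ∧
      (2 * n + 2 + a + b) * (1 - x ^ 2) * (derivative (jacobiP a b n)).eval x =
        (n + 1 + a + b) * ((2 * n + 2 + a + b) * x + a - b) * (jacobiP a b n).eval x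
          - 2 * (n + 1) * (n + 1 + a + b) * (jacobiP a b (n + 1)).eval x := by
  induction n with
  | zero =>
    constructor
    · simp [jacobiP]; ring
    · simp [jacobiP]; ring
  | succ n ih =>
    obtain ⟨hA, hB⟩ := ih
    have hn : (0 : ℝ) ≤ n := n.cast_nonneg
    have h1 : 0 < ((n : ℝ) + 2) + a + b := by linarith
    have h2 : 0 < 2 * (n : ℝ) + 2 + a + b := by linarith
    have hrec := congrArg (eval x) (jacobiP_recurrence ha hb n)
    have hrec' := congrArg (fun p => eval x (derivative p)) (jacobiP_recurrence ha hb n)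
    simp only [eval_mul, eval_C, eval_add, eval_sub, eval_X, derivative_mul, derivative_add,
      derivative_sub, derivative_C, derivative_X, eval_zero, eval_one] at hrec hrec'
    push_cast
    constructor
    · have hD : 2 * ((n : ℝ) + 2) * (((n : ℝ) + 2) + a + b) * (2 * (n : ℝ) + 2 + a + b) ^ 2 ≠ 0 := by
        positivity
      refine mul_left_cancel₀ hD ?_
      linear_combination (2 * (n : ℝ) + 4 + a + b) * (2 * n + 2 + a + b) * (1 - x ^ 2) * hrec'
        + (2 * (n : ℝ) + 4 + a + b) * (2 * n + 3 + a + b)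
          * ((2 * n + 4 + a + b) * (2 * n + 2 + a + b) * x + (a ^ 2 - b ^ 2)) * hA
        - (2 * (n : ℝ) + 4 + a + b) ^ 2 * 2 * (n + 1 + a) * (n + 1 + b) * hB
        - (2 * (n : ℝ) + 2 + a + b) * (n + 2) * (a - b - (2 * n + 4 + a + b) * x) * hrec
    · refine mul_left_cancel₀ h2.ne' ?_
      linear_combination (2 * (n : ℝ) + 4 + a + b) * hA + hrec

theorem jacobiP_ne_zero {a b : ℝ} (ha : -1 < a) (hb : -1 < b) (n : ℕ) : jacobiP a b n ≠ 0 := by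
  induction n with
  | zero => simp [jacobiP]
  | succ n ih =>
    intro h
    refine ih (Polynomial.funext fun x => ?_)
    have hs := (jacobiP_structure ha hb n x).1
    have hn : (0 : ℝ) ≤ n := n.cast_nonneg
    have h1 : 0 < (n : ℝ) + 1 + a := by linarith
    have h2 : 0 < (n : ℝ) + 1 + b := by linarith
    have h3 : 2 * ((n : ℝ) + 1 + a) * (n + 1 + b) ≠ 0 := by positivity
    simpa [h, h1.ne', h2.ne'] using hs

open Polynomial in
/-- The Jacobi differential equation. -/
theorem jacobiP_ode {a b : ℝ} (ha : -1 < a) (hb : -1 < b) {n : ℕ} (hn : 1 ≤ n) :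
    (1 - X ^ 2) * derivative (derivative (jacobiP a b n))
      + (C (b - a) - C (a + b + 2) * X) * derivative (jacobiP a b n)
      + C ((n : ℝ) * (n + a + b + 1)) * jacobiP a b n = 0 := by
  obtain ⟨n, rfl⟩ := Nat.exists_eq_add_of_le' hn
  have hX : (1 - X ^ 2 : ℝ[X]) ≠ 0 := fun h => by
    simpa using congrArg (eval 0) h
  refine (mul_eq_zero_iff_left hX).1 ?_
  refine Polynomial.funext fun x => ?_
  have hpoly : C (2 * n + 2 + a + b) * (1 - X ^ 2) * derivative (jacobiP a b (n + 1)) =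
        (C ((n + 1) * (a - b)) - C ((n + 1) * (2 * n + 2 + a + b)) * X) * jacobiP a b (n + 1)
          + C (2 * (n + 1 + a) * (n + 1 + b)) * jacobiP a b n := by
    refine Polynomial.funext fun y => ?_
    simp only [eval_mul, eval_C, eval_add, eval_sub, eval_X, eval_pow, eval_one]
    linear_combination (jacobiP_structure ha hb n y).1
  have hder := congrArg (fun p => eval x (derivative p)) hpoly
  obtain ⟨hA, hB⟩ := jacobiP_structure ha hb n x
  have hn : (0 : ℝ) ≤ n := n.cast_nonneg
  have h2 : 0 < 2 * (n : ℝ) + 2 + a + b := by linarith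
  simp only [eval_mul, eval_C, eval_add, eval_sub, eval_X, eval_pow, eval_one, derivative_mul,
    derivative_add, derivative_sub, derivative_C, derivative_X, derivative_X_pow, derivative_one,
    eval_zero] at hder ⊢
  refine mul_left_cancel₀ (pow_ne_zero 2 h2.ne') ?_
  push_cast at hder ⊢
  linear_combination (2 * (n : ℝ) + 2 + a + b) * (1 - x ^ 2) * hder
    + 2 * (n + 1 + a) * (n + 1 + b) * hB
    - (n + 1 + a + b) * ((2 * n + 2 + a + b) * x + a - b) * hA

open Polynomial in
theorem eval_derivative_prod_X_sub_C {ι : Type*} (s : Finset ι) (z : ι → ℝ) {x : ℝ}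
    (hx : ∀ j ∈ s, x ≠ z j) :
    (derivative (∏ j ∈ s, (X - C (z j)))).eval x =
        (∏ j ∈ s, (X - C (z j))).eval x * ∑ j ∈ s, (x - z j)⁻¹ ∧
      (derivative (derivative (∏ j ∈ s, (X - C (z j))))).eval x =
        (∏ j ∈ s, (X - C (z j))).eval x *
          ((∑ j ∈ s, (x - z j)⁻¹) ^ 2 - ∑ j ∈ s, ((x - z j)⁻¹) ^ 2) := by
  classical
  induction s using Finset.induction_on with
  | empty => simp
  | insert i s hi ih =>
    obtain ⟨h1, h2⟩ := ih fun j hj => hx j (Finset.mem_insert_of_mem hj)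
    have hne : x - z i ≠ 0 := sub_ne_zero.2 (hx i (Finset.mem_insert_self _ _))
    simp only [Finset.prod_insert hi, Finset.sum_insert hi, derivative_mul, derivative_sub,
      derivative_X, derivative_C, derivative_add, eval_mul, eval_add, eval_sub, eval_X, eval_C,
      h1, h2, sub_zero, one_mul]
    constructor
    · field_simp
    · field_simp
      ring

open Polynomial in
theorem eq_C_mul_prod_of_natDegree_le {N : ℕ} {p : ℝ[X]} (hp : p.natDegree ≤ N)
    (hp0 : p ≠ 0) {z : Fin N → ℝ} (hz : Function.Injective z) (hroot : ∀ i, p.eval (z i) = 0) :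
    ∃ c : ℝ, c ≠ 0 ∧ p = C c * ∏ i, (X - C (z i)) := by
  have hdvd : ∏ i, (X - C (z i)) ∣ p :=
    Finset.prod_dvd_of_coprime
      (fun i _ j _ hij => pairwise_coprime_X_sub_C hz hij)
      (fun i _ => dvd_iff_isRoot.2 (hroot i))
  have hmonic : (∏ i, (X - C (z i))).Monic := monic_prod_X_sub_C z Finset.univ
  obtain ⟨r, rfl⟩ := hdvd
  have hr0 : r ≠ 0 := right_ne_zero_of_mul hp0
  rw [hmonic.natDegree_mul' hr0, natDegree_finsetProd_X_sub_C_eq_card] at hp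
  have hr : r.natDegree = 0 := by simp at hp; exact hp
  rw [eq_C_of_natDegree_eq_zero hr] at hr0 ⊢
  exact ⟨_, fun h => hr0 (by rw [h, C_0]), mul_comm _ _⟩

/-- At an equilibrium point of the Jacobi electrostatic problem, the second-order relation
coming from the differentiated Jacobi equation bounds the sum `T` of inverse squared distances. -/
theorem jacobi_inverse_square_sum_le {A B m l x S T : ℝ} (hm : 0 < m) (hmA : m ≤ A) (hmB : m ≤ B)
    (hx : x ∈ Set.Ioo (-1 : ℝ) 1)
    (h1 : (1 - x ^ 2) * (2 * S) + (B - A - (A + B) * x) = 0)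
    (h2 : (1 - x ^ 2) * (3 * (S ^ 2 - T)) + (B - A - (A + B + 2) * x) * (2 * S)
      + (l - (A + B)) = 0) :
    T ≤ (l + 2 * m) ^ 2 / (48 * m) := by
  obtain ⟨hx1, hx2⟩ := hx
  obtain ⟨u, hu⟩ : ∃ u, u * (1 - x) = 1 := ⟨(1 - x)⁻¹, inv_mul_cancel₀ (by linarith)⟩
  obtain ⟨v, hv⟩ : ∃ v, v * (1 + x) = 1 := ⟨(1 + x)⁻¹, inv_mul_cancel₀ (by linarith)⟩
  have huv : u + v = 2 * (u * v) := by linear_combination -v * hu - u * hv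
  have hw : u * v * (1 - x ^ 2) = 1 := by linear_combination v * (1 + x) * hu + hv
  have hxw : 2 * (x * (u * v)) = u - v := by linear_combination u * hv - v * hu
  have hS : 2 * S = A * u - B * v := by
    linear_combination u * v * h1 - 2 * S * hw + A * u * hv - B * v * hu
  have hT : 12 * T = (2 * l + A * B) * (u + v) - A * (A + 4) * u ^ 2 - B * (B + 4) * v ^ 2 := by
    have h3 : 3 * (S ^ 2 - T) =
        ((A * u - B * v) + (u - v)) * (2 * S) - (l - (A + B)) * (u * v) := by
      have e1 : u * v * (B - A - (A + B + 2) * x) = -((A * u - B * v) + (u - v)) := by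
        linear_combination -A * u * hv + B * v * hu - hxw
      linear_combination u * v * h2 - 3 * (S ^ 2 - T) * hw - 2 * S * e1
    rw [hS] at h3
    have h4 : 4 * S ^ 2 = (A * u - B * v) ^ 2 := by rw [← hS]; ring
    linear_combination -4 * h3 + 3 * h4 - (2 * l + A * B) * huv
  rw [le_div_iff₀ (by positivity)]
  have k1 : m * u ^ 2 ≤ A * u ^ 2 := by gcongr
  have k2 : m * v ^ 2 ≤ B * v ^ 2 := by gcongr
  have k3 : u ^ 2 + v ^ 2 = 4 * (u * v) ^ 2 - 2 * (u * v) := by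
    linear_combination (u + v + 2 * (u * v)) * huv
  have k4 : 12 * T ≤ 4 * ((l + 2 * m) * (u * v) - 4 * m * (u * v) ^ 2) := by
    rw [huv] at hT
    nlinarith [sq_nonneg (A * u - B * v)]
  nlinarith [mul_le_mul_of_nonneg_left k4 hm.le, sq_nonneg (8 * m * (u * v) - (l + 2 * m))]

open Polynomial in
theorem jacobi_roots_gap_sq_ge {a b m : ℝ} (ha : -1 < a) (hb : -1 < b) (hm : 0 < m)
    (hma : m ≤ a + 1) (hmb : m ≤ b + 1) {N : ℕ} {z : Fin N → ℝ} (hz : Function.Injective z)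
    (hmem : ∀ i, z i ∈ Set.Ioo (-1 : ℝ) 1)
    (hroot : ∀ i, (jacobiP a b N).eval (z i) = 0) {i k : Fin N} (hik : i ≠ k) :
    1 ≤ (z i - z k) ^ 2 * ((N * (N + a + b + 1) + 2 * m) ^ 2 / (48 * m)) := by
  obtain ⟨c, hc, hp⟩ := eq_C_mul_prod_of_natDegree_le (natDegree_jacobiP_le a b N)
    (jacobiP_ne_zero ha hb N) hz hroot
  have hne : ∀ j ∈ Finset.univ.erase i, z i ≠ z j := fun j hj =>
    hz.ne (Finset.ne_of_mem_erase hj).symm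
  obtain ⟨hq1, hq2⟩ := eval_derivative_prod_X_sub_C (Finset.univ.erase i) z hne
  rw [← Finset.mul_prod_erase _ _ (Finset.mem_univ i)] at hp
  have hq0 : (∏ j ∈ Finset.univ.erase i, (X - C (z j))).eval (z i) ≠ 0 := by
    rw [eval_prod, Finset.prod_ne_zero_iff]
    intro j hj
    simpa [sub_eq_zero] using hne j hj
  set q := ∏ j ∈ Finset.univ.erase i, (X - C (z j))
  have hN : 1 ≤ N := i.pos
  have hode := jacobiP_ode ha hb hN
  have e1 := congrArg (eval (z i)) hode
  have e2 := congrArg (fun p => eval (z i) (derivative p)) hode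
  rw [hp] at e1 e2
  simp only [derivative_mul, derivative_sub, derivative_X, derivative_C, derivative_add, eval_mul,
    eval_add, eval_sub, eval_X, eval_C, derivative_one, derivative_zero, eval_one, eval_zero,
    derivative_X_pow, eval_pow, hq1, hq2] at e1 e2
  have hcq := mul_ne_zero hc hq0
  have hT := jacobi_inverse_square_sum_le (A := a + 1) (B := b + 1) (l := N * (N + a + b + 1))
    (S := ∑ j ∈ Finset.univ.erase i, (z i - z j)⁻¹)
    (T := ∑ j ∈ Finset.univ.erase i, (z i - z j)⁻¹ ^ 2) hm hma hmb (hmem i)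
    (by
      refine mul_left_cancel₀ hcq ?_
      linear_combination e1)
    (by
      refine mul_left_cancel₀ hcq ?_
      push_cast at e2
      linear_combination e2)
  have hk : (z i - z k)⁻¹ ^ 2 ≤ ∑ j ∈ Finset.univ.erase i, (z i - z j)⁻¹ ^ 2 :=
    Finset.single_le_sum (f := fun j => (z i - z j)⁻¹ ^ 2) (fun _ _ => sq_nonneg _)
      (Finset.mem_erase.2 ⟨hik.symm, Finset.mem_univ k⟩)
  have hd : z i - z k ≠ 0 := sub_ne_zero.2 (hz.ne hik)
  calc (1 : ℝ) = (z i - z k) ^ 2 * (z i - z k)⁻¹ ^ 2 := by field_simp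
    _ ≤ _ := by gcongr; exact hk.trans hT

/-- For the ordered roots `-1 < z 0 < … < z (N-1) < 1` of the Jacobi
polynomial `P_N^{(α,β)}` (`α, β > -1`, `N ≥ 2`), with
`M = max_{j=1,…,N} 2j(2N+α+β+1-j)`, consecutive roots satisfy
`z (i+1) - z i ≥ (2^{7/4}/M)·√(min(α+1, β+1))`; moreover, if `α = β`, then
`z (i+1) - z i ≥ 2^{11/4}·√(α+1)/√(M(M+4(α+1)))`. -/
theorem jacobi_roots_gap_ge
    (α β : ℝ) (hα : -1 < α) (hβ : -1 < β) (N : ℕ) (hN : 2 ≤ N)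
    (z : Fin N → ℝ) (hz : StrictMono z)
    (hmem : ∀ i, z i ∈ Set.Ioo (-1 : ℝ) 1)
    (hroot : ∀ i, (jacobiP α β N).eval (z i) = 0) (M : ℝ)
    (hM : IsGreatest
      ((fun j : ℕ => 2 * (j : ℝ) * (2 * (N : ℝ) + α + β + 1 - (j : ℝ))) ''
        Set.Icc 1 N) M) :
    (∀ i : ℕ, (hi : i + 1 < N) →
        z ⟨i + 1, hi⟩ - z ⟨i, Nat.lt_of_succ_lt hi⟩
          ≥ (2 : ℝ) ^ ((7 : ℝ) / 4) / M * Real.sqrt (min (α + 1) (β + 1)))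
      ∧ (α = β → ∀ i : ℕ, (hi : i + 1 < N) →
          z ⟨i + 1, hi⟩ - z ⟨i, Nat.lt_of_succ_lt hi⟩
            ≥ (2 : ℝ) ^ ((11 : ℝ) / 4) * Real.sqrt (α + 1)
                / Real.sqrt (M * (M + 4 * (α + 1)))) := by
  set m := min (α + 1) (β + 1) with hm_def
  have hm : 0 < m := lt_min (by linarith) (by linarith)
  have hma : m ≤ α + 1 := min_le_left _ _
  have hmb : m ≤ β + 1 := min_le_right _ _
  have hN' : (2 : ℝ) ≤ N := by exact_mod_cast hN
  obtain ⟨l, hl⟩ : ∃ l, l = (N : ℝ) * (N + α + β + 1) := ⟨_, rfl⟩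
  have hlm : 4 * m ≤ l := by
    rw [hl]
    nlinarith
  have hMl : 2 * l ≤ M :=
    le_of_eq_of_le (by rw [hl]; ring) (hM.2 ⟨N, Set.mem_Icc.2 ⟨by omega, le_rfl⟩, rfl⟩)
  have hl0 : 0 < l := by linarith
  have hM0 : 0 < M := by linarith
  have hpos : ∀ i : ℕ, (hi : i + 1 < N) →
      0 < z ⟨i + 1, hi⟩ - z ⟨i, Nat.lt_of_succ_lt hi⟩ := fun i hi =>
    sub_pos.2 (hz (Fin.mk_lt_mk.2 (Nat.lt_succ_self i)))
  have hgap : ∀ i : ℕ, (hi : i + 1 < N) →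
      48 * m ≤ (z ⟨i + 1, hi⟩ - z ⟨i, Nat.lt_of_succ_lt hi⟩) ^ 2 * (l + 2 * m) ^ 2 := by
    intro i hi
    have h := jacobi_roots_gap_sq_ge hα hβ hm hma hmb hz.injective hmem hroot
      (i := ⟨i + 1, hi⟩) (k := ⟨i, Nat.lt_of_succ_lt hi⟩) (by simp)
    rwa [← hl, ← mul_div_assoc, le_div_iff₀ (by positivity), one_mul] at h
  refine ⟨fun i hi => ?_, fun hαβ i hi => ?_⟩
  · have hd := hpos i hi
    have hg := hgap i hi
    set d := z ⟨i + 1, hi⟩ - z ⟨i, Nat.lt_of_succ_lt hi⟩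
    have hpow : (2 : ℝ) ^ ((7 : ℝ) / 4) ≤ 4 :=
      (Real.rpow_le_rpow_of_exponent_le one_le_two (by norm_num : (7 : ℝ) / 4 ≤ (2 : ℕ))).trans
        (by rw [Real.rpow_natCast]; norm_num)
    have key : Real.sqrt m ≤ d * M / 4 := by
      refine Real.sqrt_le_iff.2 ⟨by positivity, ?_⟩
      have : d ^ 2 * (l + 2 * m) ^ 2 ≤ d ^ 2 * M ^ 2 := by gcongr; linarith
      linarith
    calc (2 : ℝ) ^ ((7 : ℝ) / 4) / M * Real.sqrt m ≤ 4 / M * (d * M / 4) := by gcongr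
      _ = d := by field_simp
  · have hd := hpos i hi
    have hg := hgap i hi
    set d := z ⟨i + 1, hi⟩ - z ⟨i, Nat.lt_of_succ_lt hi⟩
    have hmeq : α + 1 = m := by rw [hm_def, ← hαβ, min_self]
    rw [hmeq]
    have hpow : (2 : ℝ) ^ ((11 : ℝ) / 4) ≤ 8 :=
      (Real.rpow_le_rpow_of_exponent_le one_le_two (by norm_num : (11 : ℝ) / 4 ≤ (3 : ℕ))).trans
        (by rw [Real.rpow_natCast]; norm_num)
    have hMM : 0 < M * (M + 4 * m) := by positivity
    rw [ge_iff_le, div_le_iff₀ (Real.sqrt_pos.2 hMM)]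
    have h64 : 64 * m ≤ d ^ 2 * (M * (M + 4 * m)) := by
      have h1 : 4 / 3 * (l + 2 * m) ^ 2 ≤ M * (M + 4 * m) := by
        have : 2 * l * (2 * l + 4 * m) ≤ M * (M + 4 * m) := by gcongr
        nlinarith
      have h2 := mul_le_mul_of_nonneg_left h1 (sq_nonneg d)
      linarith
    calc (2 : ℝ) ^ ((11 : ℝ) / 4) * Real.sqrt m ≤ 8 * Real.sqrt m := by gcongr
      _ = Real.sqrt (64 * m) := by
        rw [Real.sqrt_mul (by norm_num), show (64 : ℝ) = 8 ^ 2 by norm_num,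
          Real.sqrt_sq (by norm_num)]
      _ ≤ Real.sqrt (d ^ 2 * (M * (M + 4 * m))) := Real.sqrt_le_sqrt h64
      _ = d * Real.sqrt (M * (M + 4 * m)) := by
        rw [Real.sqrt_mul (sq_nonneg d), Real.sqrt_sq hd.le]
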